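/- Let c̃ ∈ C̃ satisfy μ(c̃) = m. Let π̂ be the self-map of {0, 1, …, m−1} × G̃/(Ũ ∩ M̃) sending (p, z̃(Ũ ∩ M̃)) to (p+1, z̃(Ũ ∩ M̃)) for 0 ≤ p ≤ m−2 and sending (m−1, z̃(Ũ ∩ M̃)) to (0, z̃c̃(Ũ ∩ M̃)). Then π̂ is well defined and α(U) ∘ π̂ = (id_{G/U} × sh₁) ∘ α(U), where sh₁ : ℤ → ℤ is the shift k ↦ k + 1. -/

import Mathlib

/-- Right multiplication by an element of `pr.ker` descends to the left cosets of
`U.comap pr ⊓ μ.ker`. -/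
theorem leftRel_mul_right_of_mem_ker {H G A : Type*} [Group H] [Group G] [CommGroup A]
    (pr : H →* G) (μ : H →* A) (U : Subgroup G) {c : H} (hc : c ∈ pr.ker) {a b : H}
    (hab : QuotientGroup.leftRel (U.comap pr ⊓ μ.ker) a b) :
    QuotientGroup.leftRel (U.comap pr ⊓ μ.ker) (a * c) (b * c) := by
  rw [MonoidHom.mem_ker] at hc
  simp only [QuotientGroup.leftRel_apply, Subgroup.mem_inf, Subgroup.mem_comap,
    MonoidHom.mem_ker, map_mul, map_inv, hc, mul_one, inv_mul_eq_one] at hab ⊢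
  exact ⟨hab.1, by rw [hab.2]⟩

/-- Setting as in Statement 7: `pr : G̃ → G` surjective with kernel `C̃`,
`μ : G̃ →* Multiplicative ℤ` with kernel `M̃`, `m ≥ 1` with `μ(C̃) = mℤ`, and `U ≤ G`
with `μ(Ũ) = mℤ` for `Ũ = pr⁻¹(U)`; `α(U)` is the map
`(p, z̃(Ũ ∩ M̃)) ↦ (pr(z̃)U, μ(z̃)+p)`.

Let `c̃ ∈ C̃` satisfy `μ(c̃) = m`.  Let `π̂` be the self-map of
`{0,…,m−1} × G̃/(Ũ ∩ M̃)` sending `(p, z̃(Ũ∩M̃))` to `(p+1, z̃(Ũ∩M̃))` for `p ≤ m−2` and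
`(m−1, z̃(Ũ∩M̃))` to `(0, z̃c̃(Ũ∩M̃))` (below: `p ↦ p+1` in `Fin m`, which wraps around,
with the representative multiplied by `c̃` exactly when `p = m−1`).  Then `π̂` is well
defined and `α(U) ∘ π̂ = (id × sh₁) ∘ α(U)` where `sh₁ : ℤ → ℤ, k ↦ k+1`. -/
theorem statement8 {Gt G : Type*} [Group Gt] [Group G] (pr : Gt →* G)
    (hpr : Function.Surjective pr) (μ : Gt →* Multiplicative ℤ) (m : ℕ) [NeZero m]
    (hC : Subgroup.map μ pr.ker = Subgroup.zpowers (Multiplicative.ofAdd (m : ℤ)))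
    (U : Subgroup G)
    (hU : Subgroup.map μ (U.comap pr) = Subgroup.zpowers (Multiplicative.ofAdd (m : ℤ)))
    (c : Gt) (hc : c ∈ pr.ker) (hcμ : μ c = Multiplicative.ofAdd (m : ℤ)) :
    ∃ α : Fin m × (Gt ⧸ (U.comap pr ⊓ μ.ker)) → (G ⧸ U) × ℤ,
      (∀ (p : Fin m) (z : Gt),
        α (p, QuotientGroup.mk z) =
          (QuotientGroup.mk (pr z), Multiplicative.toAdd (μ z) + (p : ℤ))) ∧
      ∃ πhat : Fin m × (Gt ⧸ (U.comap pr ⊓ μ.ker)) →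
          Fin m × (Gt ⧸ (U.comap pr ⊓ μ.ker)),
        (∀ (p : Fin m) (z : Gt),
          πhat (p, QuotientGroup.mk z) =
            (p + 1, QuotientGroup.mk (z * if (p : ℕ) = m - 1 then c else 1))) ∧
        ∀ y, α (πhat y) = ((α y).1, (α y).2 + 1) := by
  refine ⟨fun y => (Quotient.map' (s₂ := QuotientGroup.leftRel U) pr ?_ y.2,
    Quotient.liftOn' y.2 (fun z => Multiplicative.toAdd (μ z)) ?_ + (y.1 : ℤ)),
    fun p z => rfl,
    fun y => (y.1 + 1, Quotient.map' (fun z => z * if (y.1 : ℕ) = m - 1 then c else 1) ?_ y.2),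
    fun p z => rfl, ?_⟩
  · intro a b hab
    rw [QuotientGroup.leftRel_apply] at hab ⊢
    simpa using hab.1
  · intro a b hab
    rw [QuotientGroup.leftRel_apply] at hab
    have h : μ (a⁻¹ * b) = 1 := hab.2
    rw [map_mul, map_inv, inv_mul_eq_one] at h
    exact congrArg Multiplicative.toAdd h
  · intro a b hab
    refine leftRel_mul_right_of_mem_ker pr μ U ?_ hab
    split_ifs
    exacts [hc, one_mem _]
  · rintro ⟨p, z⟩
    induction z using Quotient.inductionOn' with
    | h z =>
      have hm : 0 < m := Nat.pos_of_neZero m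
      have hp := p.isLt
      rw [MonoidHom.mem_ker] at hc
      have hval : ((p + 1 : Fin m) : ℕ) = if (p : ℕ) = m - 1 then 0 else (p : ℕ) + 1 := by
        rw [Fin.val_add, Fin.coe_ofNat_eq_mod, Nat.add_mod_mod]
        split_ifs with h
        · rw [h, Nat.sub_add_cancel hm, Nat.mod_self]
        · exact Nat.mod_eq_of_lt (by omega)
      refine Prod.ext ?_ ?_
      · change (QuotientGroup.mk (pr (z * _)) : G ⧸ U) = QuotientGroup.mk (pr z)
        split_ifs <;> simp [hc]
      · change Multiplicative.toAdd (μ (z * _)) + (((p + 1 : Fin m) : ℕ) : ℤ) =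
          Multiplicative.toAdd (μ z) + ((p : ℕ) : ℤ) + 1
        rw [hval]
        by_cases h : (p : ℕ) = m - 1
        · rw [if_pos h, if_pos h, map_mul, hcμ, toAdd_mul, toAdd_ofAdd]
          omega
        · rw [if_neg h, if_neg h, mul_one]
          push_cast
          ring
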